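/- arXiv:1903.10358 — 3 statements merged into one kernel-verified Lean document; each statement's English description precedes it below -/
import Mathlib

section
/- Let H be a complex Hilbert space and let S, T be normal bounded linear operators on H such that ST is normal. Then ‖ |ST|^{1/2} ‖ ≤ ‖ |TS|^{1/2} ‖, where |X| = (X*X)^{1/2} denotes the absolute value; equivalently, ‖ST‖ ≤ ‖TS‖ in the operator norm. -/
open ContinuousLinearMap

/-- The absolute value `|X| = (X*X)^{1/2}` of a bounded operator, via the
continuous functional calculus. -/
noncomputable def opAbs {H : Type*} [NormedAddCommGroup H] [InnerProductSpace ℂ H]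
    [CompleteSpace H] (X : H →L[ℂ] H) : H →L[ℂ] H :=
  CFC.sqrt (star X * X)

namespace spectrum

/-- Reversing the factors of a product does not decrease the spectral radius. -/
theorem spectralRadius_mul_le_comm {𝕜 A : Type*} [NormedField 𝕜] [Ring A] [Algebra 𝕜 A] (a b : A) :
    spectralRadius 𝕜 (a * b) ≤ spectralRadius 𝕜 (b * a) := by
  refine iSup₂_le fun k hk => ?_
  by_cases h0 : k = 0
  · simp [h0]
  · have hk' : k ∈ spectrum 𝕜 (b * a) \ {0} := by
      rw [← nonzero_mul_comm]
      exact ⟨hk, h0⟩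
    exact le_iSup₂ (f := fun (k : 𝕜) (_ : k ∈ spectrum 𝕜 (b * a)) => (‖k‖₊ : ENNReal)) k hk'.1

end spectrum

/-- If a product in a C⋆-algebra is normal, then reversing the factors does not decrease the
norm. -/
theorem IsStarNormal.norm_mul_le_norm_mul_comm {A : Type*} [CStarAlgebra A] {a b : A}
    (h : IsStarNormal (a * b)) : ‖a * b‖ ≤ ‖b * a‖ := by
  cases subsingleton_or_nontrivial A
  · rw [Subsingleton.elim (a * b) (b * a)]
  · have key : (‖a * b‖₊ : ENNReal) ≤ ‖b * a‖₊ := calc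
      (‖a * b‖₊ : ENNReal) = spectralRadius ℂ (a * b) :=
        (IsStarNormal.spectralRadius_eq_nnnorm _).symm
      _ ≤ spectralRadius ℂ (b * a) := spectrum.spectralRadius_mul_le_comm a b
      _ ≤ ‖b * a‖₊ := spectrum.spectralRadius_le_nnnorm _
    exact_mod_cast key

theorem norm_opAbs {H : Type*} [NormedAddCommGroup H] [InnerProductSpace ℂ H]
    [CompleteSpace H] (X : H →L[ℂ] H) : ‖opAbs X‖ = ‖X‖ :=
  CFC.norm_abs

/-- if `S`, `T` and `ST` are normal operators, then
`‖|ST|^{1/2}‖ ≤ ‖|TS|^{1/2}‖`; equivalently, `‖ST‖ ≤ ‖TS‖`. -/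
theorem norm_sqrt_abs_mul_le
    {H : Type*} [NormedAddCommGroup H] [InnerProductSpace ℂ H] [CompleteSpace H]
    (S T : H →L[ℂ] H) (hS : IsStarNormal S) (hT : IsStarNormal T)
    (hST : IsStarNormal (S * T)) :
    ‖CFC.sqrt (opAbs (S * T))‖ ≤ ‖CFC.sqrt (opAbs (T * S))‖ ∧ ‖S * T‖ ≤ ‖T * S‖ := by
  have key : ‖S * T‖ ≤ ‖T * S‖ := hST.norm_mul_le_norm_mul_comm
  refine ⟨?_, key⟩
  rw [CFC.norm_sqrt (opAbs (S * T)) (CFC.sqrt_nonneg _),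
    CFC.norm_sqrt (opAbs (T * S)) (CFC.sqrt_nonneg _), norm_opAbs, norm_opAbs]
  exact Real.sqrt_le_sqrt key
end

section
/- Let H be a complex Hilbert space and let S, T, C be bounded linear operators on H. Suppose the pair (S, T) satisfies the Fuglede–Putnam property and SC = CT (i.e., C is in the kernel of the generalized derivation δ_{S,T}). Then for every bounded linear operator X on H, ‖SX − XT + C‖ ≥ ‖C‖. -/
/-- In a complex Banach algebra, a point `z` of the spectrum of `a` extends to a point `(z, w)` of
the joint spectrum of `a` and `b`, relative to the bicommutant of any commuting set `s` containing
`a` and `b`. -/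
theorem exists_not_isUnit_of_mem_spectrum {A : Type*} [NormedRing A] [NormedAlgebra ℂ A]
    [CompleteSpace A] {s : Set A} (hs : ∀ x ∈ s, ∀ y ∈ s, x * y = y * x) {a b : A} (ha : a ∈ s)
    (hb : b ∈ s) {z : ℂ} (hz : z ∈ spectrum ℂ a) :
    ∃ w : ℂ, ∀ c ∈ s.centralizer.centralizer, ∀ d ∈ s.centralizer.centralizer,
      ¬ IsUnit (c * (a - algebraMap ℂ A z) + d * (b - algebraMap ℂ A w)) := by
  let B : Subalgebra ℂ A := Subalgebra.centralizer ℂ s.centralizer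
  have hcomm : ∀ x y : B, x * y = y * x := fun x y ↦
    Subtype.ext (Set.centralizer_centralizer_comm_of_comm hs x x.2 y y.2)
  let : NormedCommRing B := { (inferInstance : NormedRing B) with mul_comm := hcomm }
  have hclosed : IsClosed (B : Set A) := Set.isClosed_centralizer _
  have : CompleteSpace B := hclosed.completeSpace_coe
  have hsB : s ⊆ B := Set.subset_centralizer_centralizer
  have hz' : z ∈ spectrum ℂ (⟨a, hsB ha⟩ : B) := spectrum.subset_subalgebra (⟨a, hsB ha⟩ : B) hz
  obtain ⟨φ, hφ⟩ := WeakDual.CharacterSpace.mem_spectrum_iff_exists.1 hz'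
  refine ⟨φ ⟨b, hsB hb⟩, fun c hc d hd hu ↦ ?_⟩
  let x : B := ⟨c, hc⟩ * (⟨a, hsB ha⟩ - algebraMap ℂ B z) +
    ⟨d, hd⟩ * (⟨b, hsB hb⟩ - algebraMap ℂ B (φ ⟨b, hsB hb⟩))
  have hx : φ x = 0 := by
    simp only [x, map_add, map_mul, map_sub, AlgHomClass.commutes, hφ]
    simp
  obtain ⟨u, hu⟩ := hu
  have hux : (u : A) = x := hu
  have hinv : (↑u⁻¹ : A) ∈ B := by
    intro t ht
    have : Commute t u := hux ▸ x.2 t ht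
    exact this.units_inv_right
  have hone : x * ⟨_, hinv⟩ = 1 := Subtype.ext (by simp [← hux])
  have := congrArg φ hone
  simp [hx] at this

open ContinuousLinearMap in
/-- A positive operator `P` and a normal operator `N` which commute have a joint approximate
eigenvector for the eigenvalue `‖P‖` of `P`. -/
theorem exists_joint_approx_eigenvector {H : Type*} [NormedAddCommGroup H] [InnerProductSpace ℂ H]
    [CompleteSpace H] [Nontrivial H] {P N : H →L[ℂ] H} (hP : 0 ≤ P) (hN : IsStarNormal N)
    (hPN : Commute P N) :
    ∃ w : ℂ, ∀ ε : ℝ, 0 < ε → ∃ x : H, ‖P x - (‖P‖ : ℂ) • x‖ ≤ ε * ‖x‖ ∧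
      ‖N x - w • x‖ ≤ ε * ‖x‖ ∧ ‖star N x - star w • x‖ ≤ ε * ‖x‖ ∧ x ≠ 0 := by
  have hPs : star P = P := (IsSelfAdjoint.of_nonneg hP).star_eq
  have hPN' : Commute P (star N) := by simpa [hPs] using hPN.star_star
  have hNN : Commute (star N) N := hN.star_comm_self
  have hs : ∀ x ∈ ({P, N, star N} : Set (H →L[ℂ] H)), ∀ y ∈ ({P, N, star N} : Set (H →L[ℂ] H)),
      x * y = y * x := by
    rintro x (rfl | rfl | rfl) y (rfl | rfl | rfl)
    exacts [rfl, hPN, hPN', hPN.symm, rfl, hNN.symm, hPN'.symm, hNN, rfl]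
  have hz : (‖P‖ : ℂ) ∈ spectrum ℂ P :=
    spectrum.algebraMap_mem ℂ (CStarAlgebra.norm_mem_spectrum_of_nonneg hP)
  obtain ⟨w, hw⟩ := exists_not_isUnit_of_mem_spectrum hs (b := N) (by simp) (by simp) hz
  refine ⟨w, fun ε hε ↦ ?_⟩
  let B : Subalgebra ℂ (H →L[ℂ] H) :=
    Subalgebra.centralizer ℂ ({P, N, star N} : Set (H →L[ℂ] H)).centralizer
  have hsB : ({P, N, star N} : Set (H →L[ℂ] H)) ⊆ B := Set.subset_centralizer_centralizer
  set E := P - algebraMap ℂ (H →L[ℂ] H) ‖P‖ with hE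
  set F := N - algebraMap ℂ (H →L[ℂ] H) w with hF
  have hFs : star F = star N - algebraMap ℂ (H →L[ℂ] H) (star w) := by
    rw [hF, star_sub, algebraMap_star_comm]
  have hEs : star E = E := by
    rw [hE, star_sub, hPs, ← algebraMap_star_comm]
    simp
  have h := hw (star E) (hEs.symm ▸ B.sub_mem (hsB (Set.mem_insert P _)) (B.algebraMap_mem _)) (star F)
    (hFs.symm ▸ B.sub_mem (hsB (by simp)) (B.algebraMap_mem _))
  have hsq : ∀ (G : H →L[ℂ] H) (x : H), inner ℂ ((star G * G) x) x = ((‖G x‖ ^ 2 : ℝ) : ℂ) := by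
    intro G x
    change inner ℂ (star G (G x)) x = _
    rw [star_eq_adjoint, adjoint_inner_left, inner_self_eq_norm_sq_to_K]
    simp
  have hx : ∃ x, ‖E x‖ ^ 2 + ‖F x‖ ^ 2 < ‖x‖ ^ 2 * ε ^ 2 := by
    by_contra! hcon
    refine h (isUnit_of_forall_le_norm_inner_map _ (c := ⟨ε ^ 2, by positivity⟩)
      (by exact_mod_cast (by positivity : 0 < ε ^ 2)) fun x ↦ ?_)
    rw [add_apply, inner_add_left, hsq, hsq, ← Complex.ofReal_add, Complex.norm_real,
      Real.norm_of_nonneg (by positivity)]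
    exact hcon x
  obtain ⟨x, hx⟩ := hx
  have hEx : ‖E x‖ ≤ ε * ‖x‖ :=
    abs_le_of_sq_le_sq' (by nlinarith [sq_nonneg ‖F x‖]) (by positivity) |>.2
  have hFx : ‖F x‖ ≤ ε * ‖x‖ :=
    abs_le_of_sq_le_sq' (by nlinarith [sq_nonneg ‖E x‖]) (by positivity) |>.2
  have hFn : IsStarNormal F := by
    refine ⟨?_⟩
    rw [hFs]
    exact (hNN.sub_right (Algebra.commutes _ _).symm).sub_left (Algebra.commutes _ _)
  have hFx' : ‖star F x‖ = ‖F x‖ := by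
    have h₁ := hsq F x
    have h₂ := hsq (star F) x
    rw [star_star, ← hFn.star_comm_self.eq, h₁] at h₂
    exact (sq_eq_sq₀ (norm_nonneg _) (norm_nonneg _)).1 (by exact_mod_cast h₂.symm)
  refine ⟨x, ?_, ?_, ?_, ?_⟩
  · simpa [hE, Algebra.algebraMap_eq_smul_one] using hEx
  · simpa [hF, Algebra.algebraMap_eq_smul_one] using hFx
  · simpa [hFs, Algebra.algebraMap_eq_smul_one] using hFx'.le.trans hFx
  · rintro rfl
    simp at hx

open ContinuousLinearMap in
/-- A positive operator `P` commuting with `S`, such that `S` is normal on the range of `P`, is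
Birkhoff–James orthogonal to the range of the inner derivation induced by `S`. -/
theorem norm_le_norm_commutator_add {H : Type*} [NormedAddCommGroup H] [InnerProductSpace ℂ H]
    [CompleteSpace H] {P S : H →L[ℂ] H} (hP : 0 ≤ P) (hPS : Commute P S)
    (hS : star S * S * P = S * star S * P) (Y : H →L[ℂ] H) :
    ‖P‖ ≤ ‖S * Y - Y * S + P‖ := by
  rcases eq_or_ne P 0 with rfl | hP0
  · simp
  have : Nontrivial H := by
    by_contra hH
    rw [not_nontrivial_iff_subsingleton] at hH
    exact hP0 (ContinuousLinearMap.ext fun x ↦ Subsingleton.elim _ _)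
  have hPs : star P = P := (IsSelfAdjoint.of_nonneg hP).star_eq
  have hPS' : Commute P (star S) := by simpa [hPs] using hPS.star_star
  have hNs : star (S * P) = star S * P := by rw [star_mul, hPs, hPS'.eq]
  have hN : IsStarNormal (S * P) := by
    refine ⟨?_⟩
    rw [hNs]
    calc star S * P * (S * P) = star S * (P * S) * P := by simp only [mul_assoc]
      _ = star S * S * P * P := by rw [hPS.eq]; simp only [mul_assoc]
      _ = S * (star S * P) * P := by rw [hS]; simp only [mul_assoc]
      _ = S * P * (star S * P) := by rw [← hPS'.eq]; simp only [mul_assoc]; rw [hPS'.eq]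
  obtain ⟨w, hw⟩ := exists_joint_approx_eigenvector hP hN (hPS.mul_right (Commute.refl P))
  set p := ‖P‖ with hp
  have hp0 : 0 < p := norm_pos_iff.2 hP0
  set D := S * Y - Y * S + P with hD
  refine le_of_forall_pos_le_add fun δ hδ ↦ ?_
  set K := 1 + 2 * ‖Y‖ * ((‖S‖ + 1) / p) with hK
  have hK0 : 0 < K := by positivity
  obtain ⟨x, h₁, h₂, h₃, hx⟩ := hw (δ / K) (by positivity)
  rw [hNs] at h₃
  set ε := δ / K with hε
  have hε0 : 0 < ε := by positivity
  have hx0 : 0 < ‖x‖ := norm_pos_iff.2 hx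
  have hpc : (p : ℂ) ≠ 0 := by exact_mod_cast hp0.ne'
  have key : ∀ (R : H →L[ℂ] H) (v : ℂ), ‖(R * P) x - v • x‖ ≤ ε * ‖x‖ →
      ‖R x - (v / p) • x‖ ≤ (‖R‖ + 1) / p * (ε * ‖x‖) := by
    intro R v hv
    have : R x - (v / p) • x = (p : ℂ)⁻¹ • (((R * P) x - v • x) - R (P x - (p : ℂ) • x)) := by
      simp only [show (R * P) x = R (P x) from rfl, map_sub, map_smul, smul_sub, smul_smul,
        inv_mul_cancel₀ hpc, one_smul, div_eq_inv_mul]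
      abel
    rw [this, norm_smul, norm_inv, Complex.norm_real, Real.norm_of_nonneg hp0.le, div_mul_eq_mul_div,
      inv_mul_eq_div]
    gcongr
    calc _ ≤ ‖(R * P) x - v • x‖ + ‖R (P x - (p : ℂ) • x)‖ := norm_sub_le _ _
      _ ≤ ε * ‖x‖ + ‖R‖ * (ε * ‖x‖) := by
          gcongr
          exact (R.le_opNorm _).trans (by gcongr)
      _ = _ := by ring
  have k₁ := key S w h₂
  have k₂ := key (star S) (star w) h₃
  rw [norm_star] at k₂
  have hid : ((p * ‖x‖ ^ 2 : ℝ) : ℂ) = inner ℂ x (D x) - inner ℂ x (P x - (p : ℂ) • x)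
      - inner ℂ (star S x - (star w / p) • x) (Y x) + inner ℂ x (Y (S x - (w / p) • x)) := by
    simp only [hD, add_apply, sub_apply, inner_add_right, inner_sub_right,
      inner_sub_left, inner_smul_left, inner_smul_right, map_sub, map_smul, star_eq_adjoint,
      adjoint_inner_left, inner_self_eq_norm_sq_to_K]
    simp
    ring
  have hle : p * ‖x‖ ^ 2 ≤ (‖D‖ + δ) * ‖x‖ ^ 2 := by
    calc p * ‖x‖ ^ 2 = ‖((p * ‖x‖ ^ 2 : ℝ) : ℂ)‖ := by
          rw [Complex.norm_real, Real.norm_of_nonneg (by positivity)]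
      _ ≤ ‖x‖ * (‖D‖ * ‖x‖) + ‖x‖ * (ε * ‖x‖) +
          ((‖S‖ + 1) / p * (ε * ‖x‖)) * (‖Y‖ * ‖x‖) +
          ‖x‖ * (‖Y‖ * ((‖S‖ + 1) / p * (ε * ‖x‖))) := by
          rw [hid]
          refine (norm_add_le _ _).trans (add_le_add ((norm_sub_le _ _).trans
            (add_le_add ((norm_sub_le _ _).trans (add_le_add ?_ ?_)) ?_)) ?_) <;>
          refine (norm_inner_le_norm _ _).trans ?_
          · gcongr; exact D.le_opNorm x
          · gcongr
          · gcongr; exact Y.le_opNorm x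
          · gcongr; exact (Y.le_opNorm _).trans (by gcongr)
      _ = (‖D‖ + ε * K) * ‖x‖ ^ 2 := by rw [hK]; ring
      _ = (‖D‖ + δ) * ‖x‖ ^ 2 := by rw [hε, div_mul_cancel₀ _ hK0.ne']
  exact le_of_mul_le_mul_right hle (by positivity)


/-- if the pair `(S, T)` satisfies the Fuglede–Putnam property and
`C ∈ ker δ_{S,T}` (i.e. `SC = CT`), then `‖SX − XT + C‖ ≥ ‖C‖` for every `X`. -/
theorem norm_derivation_add_ge_of_fugledePutnam
    {H : Type*} [NormedAddCommGroup H] [InnerProductSpace ℂ H] [CompleteSpace H]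
    (S T C : H →L[ℂ] H)
    (hFP : ∀ W : H →L[ℂ] H, S * W = W * T →
      ContinuousLinearMap.adjoint S * W = W * ContinuousLinearMap.adjoint T)
    (hC : S * C = C * T) :
    ∀ X : H →L[ℂ] H, ‖S * X - X * T + C‖ ≥ ‖C‖ := by
  intro X
  simp only [← ContinuousLinearMap.star_eq_adjoint] at hFP
  have hC' := hFP C hC
  have hCs : star C * S = T * star C := by simpa using congrArg star hC'
  have hSC : star S * (S * C) = S * C * star T := hFP (S * C) (by rw [mul_assoc, ← hC])
  have hPS : Commute (C * star C) S := by
    change C * star C * S = S * (C * star C)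
    rw [mul_assoc, hCs, ← mul_assoc, ← hC, mul_assoc]
  have hS : star S * S * (C * star C) = S * star S * (C * star C) := by
    rw [← mul_assoc, mul_assoc (star S), hSC, mul_assoc S, ← hC']
    simp only [mul_assoc]
  have h := norm_le_norm_commutator_add (mul_star_self_nonneg C) hPS hS (X * star C)
  have hD : S * (X * star C) - X * star C * S + C * star C = (S * X - X * T + C) * star C := by
    rw [mul_assoc X, hCs]
    noncomm_ring
  rw [hD, CStarRing.norm_self_mul_star] at h
  rcases (norm_nonneg C).eq_or_lt with h₀ | h₀
  · rw [← h₀]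
    exact norm_nonneg _
  · refine le_of_mul_le_mul_right (h.trans ((norm_mul_le _ _).trans_eq ?_)) h₀
    rw [norm_star]
end

section
/- Let H be a complex Hilbert space and let S, T be normal bounded linear operators on H. If C is a bounded linear operator with SC = CT, then for every bounded linear operator X on H, ‖SX − XT + C‖ ≥ ‖C‖. -/
section DerivationFlow

open NormedSpace

variable {A : Type*} [CStarAlgebra A]

/-- The flow `t ↦ exp (t a) x exp (-t b)` generated by the generalized derivation
`x ↦ a x - x b`. -/
noncomputable def derivationFlow (a b x : A) (t : ℝ) : A :=
  exp (t • a) * x * exp (t • -b)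

lemma derivationFlow_intertwine {a b s u c : A} (has : Commute a s) (hbu : Commute b u)
    (hc : a * c = c * b) (x : A) (t : ℝ) :
    derivationFlow a b (s * x - x * u + c) t =
      s * derivationFlow a b x t - derivationFlow a b x t * u + c := by
  let _ : NormedAlgebra ℚ A := .restrictScalars ℚ ℂ A
  have hs : exp (t • a) * s = s * exp (t • a) := (has.smul_left t).exp_left.eq
  have hu : u * exp (t • -b) = exp (t • -b) * u := (hbu.neg_left.smul_left t).exp_left.eq.symm
  have hc' : exp (t • a) * c * exp (t • -b) = c := by
    have h : SemiconjBy c (t • -b) (t • -a) := by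
      simp [SemiconjBy, hc]
    simpa using h.exp_neg_mul_mul_exp_eq_self
  calc derivationFlow a b (s * x - x * u + c) t
      = (exp (t • a) * s) * x * exp (t • -b) - exp (t • a) * x * (u * exp (t • -b))
        + exp (t • a) * c * exp (t • -b) := by unfold derivationFlow; noncomm_ring
    _ = _ := by rw [hs, hu, hc']; unfold derivationFlow; noncomm_ring

lemma hasDerivAt_derivationFlow (a b x : A) (t : ℝ) :
    HasDerivAt (derivationFlow a b x)
      (a * derivationFlow a b x t - derivationFlow a b x t * b) t := by
  convert! ((hasDerivAt_exp_smul_const' a t).mul_const x).mul (hasDerivAt_exp_smul_const (-b) t)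
    using 1
  unfold derivationFlow
  noncomm_ring

lemma norm_derivationFlow {a b : A} (ha : a ∈ skewAdjoint A) (hb : b ∈ skewAdjoint A)
    (x : A) (t : ℝ) : ‖derivationFlow a b x t‖ = ‖x‖ := by
  let _ : NormedAlgebra ℚ A := .restrictScalars ℚ ℂ A
  rw [derivationFlow,
    CStarRing.norm_mul_mem_unitary _
      (exp_mem_unitary_of_mem_skewAdjoint (skewAdjoint.smul_mem t (neg_mem hb))),
    CStarRing.norm_mem_unitary_mul _
      (exp_mem_unitary_of_mem_skewAdjoint (skewAdjoint.smul_mem t ha))]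

lemma le_of_forall_pos_mul_le_mul_add {p q d : ℝ} (h : ∀ r : ℝ, 0 < r → r * p ≤ r * q + d) :
    p ≤ q := by
  by_contra! hlt
  have hpos : 0 < p - q := sub_pos.mpr hlt
  have h1 := h ((|d| + 1) / (p - q)) (by positivity)
  have h2 : (|d| + 1) / (p - q) * (p - q) = |d| + 1 := div_mul_cancel₀ _ hpos.ne'
  linarith [le_abs_self d]

/-- The range of the generalized derivation of two skew-adjoint elements is
Birkhoff–James orthogonal to its kernel. -/
lemma norm_le_norm_derivation_add_of_mem_skewAdjoint {a b c : A} (ha : a ∈ skewAdjoint A)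
    (hb : b ∈ skewAdjoint A) (hc : a * c = c * b) (x : A) :
    ‖c‖ ≤ ‖a * x - x * b + c‖ := by
  refine le_of_forall_pos_mul_le_mul_add (d := 2 * ‖x‖) fun r hr ↦ ?_
  set F := derivationFlow a b x
  have hderiv (t : ℝ) : HasDerivAt (fun t : ℝ ↦ F t + t • c)
      (derivationFlow a b (a * x - x * b + c) t) t := by
    rw [derivationFlow_intertwine (Commute.refl a) (Commute.refl b) hc]
    convert! (hasDerivAt_derivationFlow a b x t).add ((hasDerivAt_id t).smul_const c) using 1
    rw [one_smul]
  have hmvt := norm_image_sub_le_of_norm_deriv_le_segment'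
    (fun t _ ↦ (hderiv t).hasDerivWithinAt)
    (fun t _ ↦ (norm_derivationFlow ha hb _ t).le) r (Set.right_mem_Icc.mpr hr.le)
  have hF (t : ℝ) : ‖F t‖ = ‖x‖ := norm_derivationFlow ha hb x t
  calc r * ‖c‖ = ‖r • c‖ := by rw [norm_smul, Real.norm_of_nonneg hr.le]
    _ = ‖(F r + r • c - (F 0 + (0 : ℝ) • c)) - (F r - F 0)‖ := by congr 1; module
    _ ≤ ‖a * x - x * b + c‖ * (r - 0) + (‖F r‖ + ‖F 0‖) :=
      (norm_sub_le _ _).trans <| add_le_add hmvt (norm_sub_le _ _)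
    _ = r * ‖a * x - x * b + c‖ + 2 * ‖x‖ := by rw [hF, hF]; ring

lemma norm_le_norm_derivation_add_of_isSelfAdjoint {a b c : A} (ha : IsSelfAdjoint a)
    (hb : IsSelfAdjoint b) (hc : a * c = c * b) (x : A) :
    ‖c‖ ≤ ‖a * x - x * b + c‖ := by
  have h := norm_le_norm_derivation_add_of_mem_skewAdjoint
    (ha.smul_mem_skewAdjoint Complex.conj_I) (hb.smul_mem_skewAdjoint Complex.conj_I)
    (c := c) (by simp [hc]) (-Complex.I • x)
  simpa [smul_smul] using h

/-- The range of the generalized derivation of two normal elements is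
Birkhoff–James orthogonal to its kernel. -/
lemma norm_le_norm_derivation_add_of_isStarNormal {s u c : A} (hs : IsStarNormal s)
    (hu : IsStarNormal u) (hc : s * c = c * u) (x : A) :
    ‖c‖ ≤ ‖s * x - x * u + c‖ := by
  have hc' : star s * c = c * star u :=
    (SemiconjBy.star_right hu hs (x := c) hc.symm).eq.symm
  set a := s - star s with ha_def
  set b := u - star u with hb_def
  have ha : a ∈ skewAdjoint A := by simp [skewAdjoint.mem_iff, ha_def]
  have hb : b ∈ skewAdjoint A := by simp [skewAdjoint.mem_iff, hb_def]
  have has : Commute a s := (Commute.refl s).sub_left hs.star_comm_self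
  have hbu : Commute b u := (Commute.refl u).sub_left hu.star_comm_self
  have hac : a * c = c * b := by rw [ha_def, hb_def, sub_mul, mul_sub, hc, hc']
  set y := s * x - x * u + c with hy
  set F := derivationFlow a b x
  have hF (t : ℝ) : ‖F t‖ = ‖x‖ := norm_derivationFlow ha hb x t
  have hF' (t : ℝ) : HasDerivAt F (a * F t - F t * b) t := hasDerivAt_derivationFlow a b x t
  have hFc : Continuous F := continuous_iff_continuousAt.mpr fun t ↦ (hF' t).continuousAt
  set J : ℝ → A := fun t ↦ ∫ τ in (0 : ℝ)..t, F τ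
  have hJ (t : ℝ) : HasDerivAt J (F t) t := hFc.integral_hasStrictDerivAt 0 t |>.hasDerivAt
  have hJ0 : J 0 = 0 := intervalIntegral.integral_same
  have hself (z : A) : IsSelfAdjoint (z + star z) := IsSelfAdjoint.add_star_self z
  refine le_of_forall_pos_mul_le_mul_add (d := ‖x‖) fun r hr ↦ ?_
  let K : ℝ → A := fun t ↦ (s + star s) * J t - J t * (u + star u) + t • ((2 : ℝ) • c)
  have hderiv (t : ℝ) : HasDerivAt (fun t ↦ K t + F t) ((2 : ℝ) • derivationFlow a b y t) t := by
    rw [hy, derivationFlow_intertwine has hbu hac]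
    change HasDerivAt _ ((2 : ℝ) • (s * F t - F t * u + c)) t
    convert! ((((hJ t).const_mul (s + star s)).sub ((hJ t).mul_const (u + star u))).add
      ((hasDerivAt_id t).smul_const ((2 : ℝ) • c))).add (hF' t) using 1
    generalize F t = f
    simp only [ha_def, hb_def, two_smul, one_smul]
    noncomm_ring
  have hmvt := norm_image_sub_le_of_norm_deriv_le_segment' (C := 2 * ‖y‖)
    (fun t _ ↦ (hderiv t).hasDerivWithinAt)
    (fun t _ ↦ by simp [norm_smul, norm_derivationFlow ha hb])
    r (Set.right_mem_Icc.mpr hr.le)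
  have hK0 : K 0 = 0 := by simp [K, hJ0]
  have hK : ‖r • ((2 : ℝ) • c)‖ ≤ ‖K r‖ :=
    norm_le_norm_derivation_add_of_isSelfAdjoint (hself s) (hself u)
      (by simp [add_mul, mul_add, hc, hc']) (J r)
  have hKr : ‖K r‖ ≤ 2 * ‖y‖ * (r - 0) + (‖F r‖ + ‖F 0‖) := by
    calc ‖K r‖ = ‖(K r + F r - (K 0 + F 0)) - (F r - F 0)‖ := by rw [hK0]; congr 1; abel
      _ ≤ _ := (norm_sub_le _ _).trans <| add_le_add hmvt (norm_sub_le _ _)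
  rw [norm_smul, norm_smul, Real.norm_of_nonneg hr.le, Real.norm_two] at hK
  rw [hF, hF] at hKr
  linarith

end DerivationFlow

/-- if `S, T` are normal and `SC = CT`, then
`‖SX − XT + C‖ ≥ ‖C‖` for every `X`. -/
theorem norm_derivation_add_ge_of_normal
    {H : Type*} [NormedAddCommGroup H] [InnerProductSpace ℂ H] [CompleteSpace H]
    (S T C : H →L[ℂ] H) (hS : IsStarNormal S) (hT : IsStarNormal T)
    (hC : S * C = C * T) :
    ∀ X : H →L[ℂ] H, ‖S * X - X * T + C‖ ≥ ‖C‖ := by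
  exact norm_le_norm_derivation_add_of_isStarNormal hS hT hC
end
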